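/- arXiv:2409.14124 — 2 statements merged into one kernel-verified Lean document; each statement's English description precedes it below -/
import Mathlib

section
/- Jacobi triple product for Θ_1: ∑_{n ∈ ℤ} (−1)^n q^{(n+1/2)^2} t^{n+1/2} = q^{1/4}(t^{1/2} − t^{−1/2}) ∏_{m=1}^∞ (1 − q^{2m})(1 − q^{2m} t)(1 − q^{2m}/t), for 0 < |q| < 1 and t ≠ 0, with a fixed choice of square roots q^{1/4} and t^{1/2}. -/
open Filter Topology Finset

/-- Gaussian binomial coefficients with parameter `p`. -/
noncomputable def gbin (p : ℂ) : ℕ → ℕ → ℂ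
  | _, 0 => 1
  | 0, _ + 1 => 0
  | M + 1, j + 1 => gbin p M j + p ^ (j + 1) * gbin p M (j + 1)

/-- The finite `q`-Pochhammer product. -/
noncomputable def phi (p : ℂ) (n : ℕ) : ℂ := ∏ i ∈ range n, (1 - p ^ (i + 1))

lemma gbin_zero_right (p : ℂ) (M : ℕ) : gbin p M 0 = 1 := by cases M <;> rfl

lemma gbin_succ (p : ℂ) (M j : ℕ) :
    gbin p (M + 1) (j + 1) = gbin p M j + p ^ (j + 1) * gbin p M (j + 1) := rfl

lemma gbin_eq_zero (p : ℂ) (M : ℕ) : ∀ j, M < j → gbin p M j = 0 := by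
  induction M with
  | zero => intro j hj; cases j with
    | zero => omega
    | succ j => rfl
  | succ M ih => intro j hj; cases j with
    | zero => omega
    | succ j => rw [gbin_succ, ih j (by omega), ih (j + 1) (by omega)]; simp

lemma phi_succ (p : ℂ) (n : ℕ) : phi p (n + 1) = phi p n * (1 - p ^ (n + 1)) := by
  simp [phi, prod_range_succ]

lemma gbin_mul (p : ℂ) (s : ℕ) : ∀ i j, i + j = s →
    gbin p (i + j) j * (phi p i * phi p j) = phi p (i + j) := by
  induction s with
  | zero => intro i j h
            obtain ⟨rfl, rfl⟩ : i = 0 ∧ j = 0 := by omega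
            simp [phi, gbin_zero_right]
  | succ s ih =>
    intro i j h
    cases j with
    | zero => simp [phi, gbin_zero_right]
    | succ j =>
      rw [show i + (j + 1) = (i + j) + 1 by omega, gbin_succ, phi_succ p (i + j)]
      have h1 := ih i j (by omega)
      cases i with
      | zero =>
        rw [gbin_eq_zero p (0 + j) (j + 1) (by omega), phi_succ]
        simp only [zero_add] at h1 ⊢
        linear_combination (1 - p ^ (j + 1)) * h1
      | succ i =>
        have h2 := ih i (j + 1) (by omega)
        rw [show i + (j + 1) = i + 1 + j by omega] at h2
        rw [phi_succ p j] at h2 ⊢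
        rw [phi_succ p i] at h1 ⊢
        linear_combination (1 - p ^ (j + 1)) * h1 + p ^ (j + 1) * (1 - p ^ (i + 1)) * h2

/-- The finite `q`-binomial theorem. -/
lemma qbinomial (w : ℂ) (M : ℕ) : ∀ y : ℂ, ∏ k ∈ range M, (1 + w ^ (2 * k + 1) * y) =
    ∑ j ∈ range (M + 1), gbin (w ^ 2) M j * w ^ (j * j) * y ^ j := by
  induction M with
  | zero => intro y; simp [gbin_zero_right]
  | succ M ih =>
    intro y
    rw [prod_range_succ']
    have h : ∀ k ∈ range M, (1 + w ^ (2 * (k + 1) + 1) * y) =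
        (1 + w ^ (2 * k + 1) * (w ^ 2 * y)) := by intro k _; ring
    rw [prod_congr rfl h, ih]
    have e : ∑ j ∈ range (M + 1), gbin (w ^ 2) M j * w ^ (j * j) * (w ^ 2 * y) ^ j =
        1 + ∑ j ∈ range (M + 1),
          gbin (w ^ 2) M (j + 1) * w ^ ((j + 1) * (j + 1)) * (w ^ 2 * y) ^ (j + 1) := by
      have a := sum_range_succ (fun j => gbin (w ^ 2) M j * w ^ (j * j) * (w ^ 2 * y) ^ j) (M + 1)
      rw [gbin_eq_zero _ M (M + 1) (by omega)] at a
      simp only [zero_mul, add_zero] at a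
      rw [← a, sum_range_succ']
      simp [gbin_zero_right, add_comm]
    rw [sum_range_succ' _ (M + 1)]
    have r : ∑ k ∈ range (M + 1), gbin (w ^ 2) (M + 1) (k + 1) * w ^ ((k + 1) * (k + 1)) *
        y ^ (k + 1) =
        (∑ j ∈ range (M + 1), gbin (w ^ 2) M j * w ^ (j * j) * (w ^ 2 * y) ^ j) * (w * y) +
        ∑ j ∈ range (M + 1),
          gbin (w ^ 2) M (j + 1) * w ^ ((j + 1) * (j + 1)) * (w ^ 2 * y) ^ (j + 1) := by
      rw [sum_mul, ← sum_add_distrib]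
      refine sum_congr rfl fun k _ => ?_
      rw [gbin_succ, mul_pow, mul_pow]
      ring
    rw [r, gbin_zero_right]
    simp only [mul_zero, zero_add, pow_one, pow_zero, mul_one]
    linear_combination e

lemma odd_prod (w : ℂ) (N : ℕ) : ∏ m ∈ range N, w ^ (2 * m + 1) = w ^ (N * N) := by
  induction N with
  | zero => simp
  | succ N ih => rw [prod_range_succ, ih]; ring

lemma finite_jtp (w z : ℂ) (hw : w ≠ 0) (hz : z ≠ 0) (N : ℕ) :
    ∏ m ∈ range N, ((1 + w ^ (2 * m + 1) * z) * (1 + w ^ (2 * m + 1) / z)) =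
    ∑ j ∈ range (2 * N + 1), gbin (w ^ 2) (2 * N) j *
      (w ^ (((j : ℤ) - N) ^ 2) * z ^ ((j : ℤ) - N)) := by
  have h := qbinomial w (2 * N) (z / w ^ (2 * N))
  have h1 : (∏ k ∈ range N, (1 + w ^ (2 * k + 1) * (z / w ^ (2 * N)))) * (w ^ (N * N) / z ^ N) =
      ∏ m ∈ range N, (1 + w ^ (2 * m + 1) / z) := by
    have hc : (∏ m ∈ range N, w ^ (2 * m + 1) / z) = w ^ (N * N) / z ^ N := by
      rw [prod_div_distrib, odd_prod]; simp
    rw [← prod_range_reflect, ← hc, ← prod_mul_distrib]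
    refine prod_congr rfl fun m hm => ?_
    rw [mem_range] at hm
    obtain ⟨d, rfl⟩ : ∃ d, N = m + 1 + d := ⟨N - (m + 1), by omega⟩
    rw [show m + 1 + d - 1 - m = d by omega]
    field_simp
    ring
  have h2 : ∏ k ∈ range N, (1 + w ^ (2 * (N + k) + 1) * (z / w ^ (2 * N))) =
      ∏ m ∈ range N, (1 + w ^ (2 * m + 1) * z) := by
    refine prod_congr rfl fun m _ => ?_
    field_simp
    ring
  rw [prod_mul_distrib, ← h1, ← h2]
  rw [show range (2 * N) = range (N + N) by rw [two_mul], prod_range_add] at h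
  rw [mul_comm, mul_assoc, mul_comm (w ^ (N * N) / z ^ N), ← mul_assoc, h, sum_mul]
  refine sum_congr rfl fun j _ => ?_
  have a : w ^ (((j : ℤ) - N) ^ 2) = w ^ (j * j) * w ^ (N * N) / (w ^ (2 * N)) ^ j := by
    rw [show ((j : ℤ) - N) ^ 2 = ((j * j + N * N : ℕ) : ℤ) - ((2 * N * j : ℕ) : ℤ) by
      push_cast; ring, zpow_sub₀ hw, zpow_natCast, zpow_natCast, pow_add, pow_mul w (2 * N) j]
  rw [a, zpow_sub₀ hz, zpow_natCast, zpow_natCast, div_pow]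
  ring

lemma summable_nat (w c : ℝ) (hw : 0 < w) (hw1 : w < 1) (hc : 0 < c) :
    Summable (fun n : ℕ => w ^ (n * n) * c ^ n) := by
  refine summable_of_ratio_test_tendsto_lt_one (l := 0) one_pos
    (Eventually.of_forall fun n => by positivity) ?_
  have : ∀ n : ℕ, ‖w ^ ((n + 1) * (n + 1)) * c ^ (n + 1)‖ / ‖w ^ (n * n) * c ^ n‖ =
      (w ^ 2) ^ n * (w * c) := by
    intro n
    rw [Real.norm_of_nonneg (by positivity), Real.norm_of_nonneg (by positivity)]
    rw [div_eq_iff (by positivity)]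
    ring
  simp_rw [this]
  have := (tendsto_pow_atTop_nhds_zero_of_lt_one (r := w ^ 2) (by positivity)
    (by nlinarith)).mul_const (w * c)
  simpa using this

lemma summable_int (w c : ℝ) (hw : 0 < w) (hw1 : w < 1) (hc : 0 < c) :
    Summable (fun n : ℤ => w ^ (n ^ 2) * c ^ n) := by
  refine Summable.of_nat_of_neg ?_ ?_
  · refine (summable_nat w c hw hw1 hc).congr fun n => ?_
    rw [zpow_natCast, ← zpow_natCast w]; push_cast; rw [sq]
  · refine (summable_nat w c⁻¹ hw hw1 (by positivity)).congr fun n => ?_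
    rw [zpow_neg, zpow_natCast, ← zpow_natCast w, inv_pow]; push_cast; rw [neg_sq, sq]

lemma summable_pow_shift (p : ℂ) (hp : ‖p‖ < 1) (a : ℂ) (k : ℕ) :
    Summable (fun n : ℕ => ‖a * p ^ (n + k)‖) := by
  simp only [norm_mul, norm_pow, pow_add]
  exact ((summable_geometric_of_lt_one (norm_nonneg _) hp).mul_right _).mul_left _

lemma one_sub_ne (p : ℂ) (hp : ‖p‖ < 1) (n : ℕ) : 1 - p ^ (n + 1) ≠ 0 := by
  intro h
  have : ‖p ^ (n + 1)‖ = 1 := by rw [← sub_eq_zero.mp h]; simp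
  rw [norm_pow] at this
  exact absurd this (pow_lt_one₀ (norm_nonneg _) hp (by omega)).ne

lemma phi_ne (p : ℂ) (hp : ‖p‖ < 1) (n : ℕ) : phi p n ≠ 0 :=
  prod_ne_zero_iff.mpr fun i _ => one_sub_ne p hp i

lemma phi_tendsto (p : ℂ) (hp : ‖p‖ < 1) :
    ∃ L : ℂ, L ≠ 0 ∧ Tendsto (phi p) atTop (𝓝 L) := by
  have hs := summable_pow_shift p hp (-1) 1
  refine ⟨∏' n : ℕ, (1 + (-1) * p ^ (n + 1)), ?_, ?_⟩
  · exact tprod_one_add_ne_zero_of_summable (fun i => by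
      have := one_sub_ne p hp i
      rwa [neg_one_mul, ← sub_eq_add_neg]) hs
  · have := (multipliable_one_add_of_summable hs).tendsto_prod_tprod_nat
    refine this.congr fun n => ?_
    simp [phi, sub_eq_add_neg]

lemma gbin_bound (p : ℂ) (hp : ‖p‖ < 1) : ∃ B : ℝ, ∀ M j, ‖gbin p M j‖ ≤ B := by
  obtain ⟨L, hL, ht⟩ := phi_tendsto p hp
  obtain ⟨A, hA⟩ := (Metric.isBounded_range_of_tendsto _ ht).exists_norm_le
  obtain ⟨D, hD⟩ := (Metric.isBounded_range_of_tendsto _ (ht.inv₀ hL)).exists_norm_le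
  have hA' : ∀ n, ‖phi p n‖ ≤ A := fun n => hA _ ⟨n, rfl⟩
  have hD' : ∀ n, ‖(phi p n)⁻¹‖ ≤ D := fun n => hD _ ⟨n, rfl⟩
  have hA0 : 0 ≤ A := (norm_nonneg _).trans (hA' 0)
  have hD0 : 0 ≤ D := (norm_nonneg _).trans (hD' 0)
  refine ⟨A * (D * D), fun M j => ?_⟩
  by_cases h : M < j
  · rw [gbin_eq_zero p M j h]; simp; positivity
  · obtain ⟨i, rfl⟩ : ∃ i, M = i + j := ⟨M - j, by omega⟩
    have := gbin_mul p _ i j rfl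
    have e : gbin p (i + j) j = phi p (i + j) * ((phi p i)⁻¹ * (phi p j)⁻¹) := by
      rw [← this]
      have := phi_ne p hp i
      have := phi_ne p hp j
      field_simp
    rw [e, norm_mul, norm_mul]
    gcongr <;> simp only [hA', hD']

/-- Central summand. -/
noncomputable def fterm (w z : ℂ) (N : ℕ) (n : ℤ) : ℂ :=
  if 0 ≤ (N : ℤ) + n then gbin (w ^ 2) (2 * N) ((N : ℤ) + n).toNat * (w ^ (n ^ 2) * z ^ n) else 0

lemma tsum_fterm (w z : ℂ) (N : ℕ) : ∑' n, fterm w z N n =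
    ∑ j ∈ range (2 * N + 1), gbin (w ^ 2) (2 * N) j *
      (w ^ (((j : ℤ) - N) ^ 2) * z ^ ((j : ℤ) - N)) := by
  rw [tsum_eq_sum (s := (range (2 * N + 1)).image (fun j : ℕ => (j : ℤ) - N))]
  · rw [sum_image (by intro a _ b _ h; simpa using h)]
    refine sum_congr rfl fun j _ => ?_
    simp [fterm]
  · intro n hn
    unfold fterm
    split_ifs with h
    · rw [gbin_eq_zero, zero_mul]
      by_contra h'
      apply hn
      rw [mem_image]
      exact ⟨((N : ℤ) + n).toNat, by rw [mem_range]; omega, by omega⟩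
    · rfl

lemma gbin_tendsto (p : ℂ) (hp : ‖p‖ < 1) (L : ℂ) (hL : L ≠ 0)
    (ht : Tendsto (phi p) atTop (𝓝 L)) (n : ℤ) :
    Tendsto (fun N : ℕ => gbin p (2 * N) ((N : ℤ) + n).toNat) atTop (𝓝 L⁻¹) := by
  have t1 : Tendsto (fun N : ℕ => 2 * N) atTop atTop :=
    tendsto_atTop_mono (fun N => by simp only [id]; omega) tendsto_id
  have t2 : ∀ n : ℤ, Tendsto (fun N : ℕ => ((N : ℤ) + n).toNat) atTop atTop := by
    intro n
    refine tendsto_atTop.mpr fun b => ?_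
    filter_upwards [eventually_ge_atTop (b + n.natAbs)] with N hN
    omega
  have t := (ht.comp t1).mul (((ht.comp (t2 (-n))).inv₀ hL).mul ((ht.comp (t2 n)).inv₀ hL))
  have e : L * (L⁻¹ * L⁻¹) = L⁻¹ := by field_simp
  rw [e] at t
  refine t.congr' ?_
  filter_upwards [eventually_ge_atTop n.natAbs] with N hN
  have := gbin_mul p _ ((N : ℤ) + -n).toNat ((N : ℤ) + n).toNat rfl
  rw [show ((N : ℤ) + -n).toNat + ((N : ℤ) + n).toNat = 2 * N by omega] at this
  simp only [Function.comp]
  rw [← this]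
  have := phi_ne p hp ((N : ℤ) + -n).toNat
  have := phi_ne p hp ((N : ℤ) + n).toNat
  field_simp

lemma jtp_tendsto (w z : ℂ) (hw : w ≠ 0) (hw1 : ‖w‖ < 1) (hz : z ≠ 0) :
    Tendsto (fun N => phi (w ^ 2) N *
      ∏ m ∈ range N, ((1 + w ^ (2 * m + 1) * z) * (1 + w ^ (2 * m + 1) / z))) atTop
      (𝓝 (∑' n : ℤ, w ^ (n ^ 2) * z ^ n)) := by
  have hp : ‖w ^ 2‖ < 1 := by rw [norm_pow]; exact pow_lt_one₀ (norm_nonneg _) hw1 (by norm_num)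
  obtain ⟨L, hL, ht⟩ := phi_tendsto _ hp
  obtain ⟨B, hB⟩ := gbin_bound _ hp
  have hB0 : 0 ≤ B := (norm_nonneg _).trans (hB 0 0)
  have hsum := (summable_int ‖w‖ ‖z‖ (norm_pos_iff.mpr hw) hw1 (norm_pos_iff.mpr hz)).mul_left B
  have key : Tendsto (fun N => ∑' n, fterm w z N n) atTop
      (𝓝 (∑' n : ℤ, L⁻¹ * (w ^ (n ^ 2) * z ^ n))) := by
    refine tendsto_tsum_of_dominated_convergence hsum ?_ ?_
    · intro n
      refine ((gbin_tendsto _ hp L hL ht n).mul_const _).congr' ?_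
      filter_upwards [eventually_ge_atTop n.natAbs] with N hN
      rw [fterm, if_pos (by omega)]
    · refine Eventually.of_forall fun N n => ?_
      unfold fterm
      split_ifs
      · rw [norm_mul, norm_mul, norm_zpow, norm_zpow]
        gcongr
        exact hB _ _
      · simp; positivity
  have := ht.mul key
  rw [tsum_mul_left, mul_inv_cancel_left₀ hL] at this
  refine this.congr fun N => ?_
  rw [tsum_fterm, finite_jtp w z hw hz]


/-- Jacobi triple product for `Θ₁`:
`∑_{n∈ℤ} (−1)^n q^{(n+1/2)²} t^{n+1/2}
  = q^{1/4}(t^{1/2} − t^{−1/2}) ∏_{m≥1} (1−q^{2m})(1−q^{2m}t)(1−q^{2m}/t)`,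
for `0 < |q| < 1` and `t ≠ 0`, with the fixed roots `u = q^{1/4}` and `s = t^{1/2}`
(so `q = u⁴`, `t = s²`, `q^{(n+1/2)²} = u^{(2n+1)²}`, `t^{n+1/2} = s^{2n+1}`). -/
theorem jacobi_triple_product_theta1 (u s : ℂ) (h0 : 0 < ‖u ^ 4‖) (h1 : ‖u ^ 4‖ < 1)
    (hs : s ≠ 0) :
    ∑' n : ℤ, (-1 : ℂ) ^ n * u ^ ((2 * n + 1) ^ 2) * s ^ (2 * n + 1) =
      u * (s - s⁻¹) *
        ∏' m : ℕ, ((1 - (u ^ 4) ^ (2 * (m + 1))) * (1 - (u ^ 4) ^ (2 * (m + 1)) * s ^ 2) *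
          (1 - (u ^ 4) ^ (2 * (m + 1)) / s ^ 2)) := by
  have hu : u ≠ 0 := by rintro rfl; simp at h0
  set q := u ^ 4 with hq
  have hq0 : q ≠ 0 := pow_ne_zero _ hu
  have hs2 : s ^ 2 ≠ 0 := pow_ne_zero _ hs
  have hz : -(q * s ^ 2) ≠ 0 := neg_ne_zero.mpr (mul_ne_zero hq0 hs2)
  have T := (jtp_tendsto q _ hq0 h1 hz).const_mul (u * s)
  have hp : ‖q ^ 2‖ < 1 := by rw [norm_pow]; exact pow_lt_one₀ (norm_nonneg _) h1 (by norm_num)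
  have e1 : ∑' n : ℤ, (-1 : ℂ) ^ n * u ^ ((2 * n + 1) ^ 2) * s ^ (2 * n + 1) =
      u * s * ∑' n : ℤ, q ^ (n ^ 2) * (-(q * s ^ 2)) ^ n := by
    rw [← tsum_mul_left]
    refine tsum_congr fun n => ?_
    rw [neg_eq_neg_one_mul (q * s ^ 2), mul_zpow, mul_zpow, hq]
    simp only [← zpow_natCast, ← zpow_mul]
    rw [show (2 * n + 1) ^ 2 = 1 + ((4 : ℕ) : ℤ) * n ^ 2 + ((4 : ℕ) : ℤ) * n by push_cast; ring,
      show 2 * n + 1 = 1 + ((2 : ℕ) : ℤ) * n by push_cast; ring,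
      zpow_add₀ hu, zpow_add₀ hu, zpow_add₀ hs, zpow_one, zpow_one]
    ring
  rw [e1]
  have m1 := (multipliable_one_add_of_summable (summable_pow_shift _ hp (-1) 1))
  have m2 := (multipliable_one_add_of_summable (summable_pow_shift _ hp (-s ^ 2) 1))
  have m3 := (multipliable_one_add_of_summable (summable_pow_shift _ hp (-1 / s ^ 2) 1))
  have mm := (m1.mul m2).mul m3
  have me : ∀ m : ℕ, (1 + -1 * (q ^ 2) ^ (m + 1)) * (1 + -s ^ 2 * (q ^ 2) ^ (m + 1)) *
      (1 + -1 / s ^ 2 * (q ^ 2) ^ (m + 1)) =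
      (1 - q ^ (2 * (m + 1))) * (1 - q ^ (2 * (m + 1)) * s ^ 2) *
          (1 - q ^ (2 * (m + 1)) / s ^ 2) := by
    intro m; rw [pow_mul]; ring
  simp only [me] at mm
  have T2 := mm.tendsto_prod_tprod_nat.const_mul (u * (s - s⁻¹))
  -- the extra factor
  have hx : Tendsto (fun N : ℕ => 1 - (q ^ 2) ^ N / s ^ 2) atTop (𝓝 1) := by
    have := (tendsto_pow_atTop_nhds_zero_of_norm_lt_one hp).div_const (s ^ 2)
    simpa using this.const_sub 1
  have T3 := T.mul hx
  rw [mul_one] at T3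
  refine tendsto_nhds_unique T3 (T2.congr fun N => ?_)
  clear T T2 T3 e1 m1 m2 m3 mm hx
  induction N with
  | zero => simp [phi]; field_simp
  | succ N ih =>
    rw [prod_range_succ, ← mul_assoc, ih, phi_succ, prod_range_succ]
    have a : (1 - (q ^ 2) ^ N / s ^ 2) = 1 + q ^ (2 * N + 1) / -(q * s ^ 2) := by
      rw [← pow_mul, pow_succ]; field_simp; ring
    rw [a]
    ring
end

section
/- The one-point function for self-conjugate partitions, G(t) := (∑_{λ self-conjugate} ∑_{i=1}^∞ t^{λ_i − i + 1/2} q^{|λ|}) / (∑_{λ self-conjugate} q^{|λ|}), satisfies the q-difference equation G(q^2 t) = −G(t) (as an identity of the meromorphic continuation in t, or equivalently of formal series after meromorphic continuation in t for each power of q). -/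
/-- `f : ℕ → ℕ` encodes a partition: `f i` is the `i`-th part (indices from 1),
parts are non-increasing and eventually zero. -/
def IsPartitionFun (f : ℕ → ℕ) : Prop :=
  f 0 = 0 ∧ (∀ ⦃i j : ℕ⦄, 1 ≤ i → i ≤ j → f j ≤ f i) ∧ (∃ N, ∀ i ≥ N, f i = 0)

/-- The size `|λ| = ∑ λ_i` of a partition. -/
noncomputable def partSize (f : ℕ → ℕ) : ℕ := ∑ᶠ i, f i

/-- The conjugate partition: `λᵗ_k = #{i : λ_i ≥ k}`. -/
noncomputable def conjFun (f : ℕ → ℕ) (k : ℕ) : ℕ := Set.ncard {i : ℕ | 1 ≤ i ∧ k ≤ f i}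

/-- A partition is self-conjugate if `λ = λᵗ`. -/
def SelfConjugate (f : ℕ → ℕ) : Prop := ∀ k ≥ 1, f k = conjFun f k

/-- The type of self-conjugate partitions. -/
def SCP : Type := {f : ℕ → ℕ // IsPartitionFun f ∧ SelfConjugate f}

/-- The Laurent polynomial `σ_λ(t) = ∑_{i=1}^∞ t^{λ_i−i+1/2} − 1/(t^{1/2}−t^{−1/2})`
(normal-ordered one-point summand): for a self-conjugate `λ` with Frobenius
coordinates `m_i = λ_i − i` it equals `∑_i (s^{2m_i+1} − s^{−(2m_i+1)})`, where
`s = t^{1/2}` is a fixed square root. -/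
noncomputable def sigmaFun (s : ℂ) (f : ℕ → ℕ) : ℂ :=
  ∑ i ∈ (Finset.range (partSize f + 1)).filter (fun i => 1 ≤ i ∧ i ≤ f i),
    (s ^ ((2 * (f i - i) + 1 : ℕ) : ℤ) - s ^ (-((2 * (f i - i) + 1 : ℕ) : ℤ)))

/-- The one-point function of self-conjugate partitions, meromorphically continued
in `t = s²` via `∑_{i≥1} t^{λ_i−i+1/2} = 1/(t^{1/2}−t^{−1/2}) + σ_λ(t)`:
`G(t) = 1/(s−s⁻¹) + (∑_λ q^{|λ|} σ_λ(t)) / (∑_λ q^{|λ|})`. -/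
noncomputable def onePoint (q s : ℂ) : ℂ :=
  1 / (s - s⁻¹) +
    (∑' l : SCP, q ^ partSize l.1 * sigmaFun s l.1) / (∑' l : SCP, q ^ partSize l.1)


open Finset in
lemma count_iff (P : ℕ → Prop) [DecidablePred P] (M : ℕ)
    (hdown : ∀ i, 1 ≤ i → P (i+1) → P i) (hM : ∀ i, P i → i ≤ M) (i : ℕ) (hi : 1 ≤ i) :
    i ≤ #((Icc 1 M).filter P) ↔ P i := by
  have hd : ∀ i j, 1 ≤ i → i ≤ j → P j → P i := by
    intro i j hi hij
    induction j, hij using Nat.le_induction with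
    | base => exact id
    | succ n hn ih => exact fun h => ih (hdown n (hi.trans hn) h)
  constructor
  · intro h
    by_contra hP
    have : (Icc 1 M).filter P ⊆ Ico 1 i := by
      intro k hk
      simp only [mem_filter, mem_Icc, mem_Ico] at hk ⊢
      refine ⟨hk.1.1, ?_⟩
      by_contra hlt
      exact hP (hd i k hi (by omega) hk.2)
    have := card_le_card this
    simp at this
    omega
  · intro h
    have : Icc 1 i ⊆ (Icc 1 M).filter P := by
      intro k hk
      simp only [mem_filter, mem_Icc] at hk ⊢
      have := hd k i hk.1 hk.2 h
      exact ⟨⟨hk.1, hM k this⟩, this⟩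
    have := card_le_card this
    simpa using this

/-- symmetric condition equivalent to being self-conjugate -/
lemma conj_iff {f : ℕ → ℕ} (hf : IsPartitionFun f) {i j : ℕ} (hi : 1 ≤ i) (hj : 1 ≤ j) :
    j ≤ conjFun f i ↔ i ≤ f j := by
  classical
  obtain ⟨h0, hmono, N, hN⟩ := hf
  have h1 : ∀ k, i ≤ f k → k ≤ N := by
    intro k hk
    by_contra h
    have := hN k (by omega)
    omega
  have := count_iff (fun k => i ≤ f k) N
    (fun k hk h => h.trans (hmono hk (by omega))) h1 j hj
  rw [← this]
  have : {k : ℕ | 1 ≤ k ∧ i ≤ f k} = (((Finset.Icc 1 N).filter (fun k => i ≤ f k) : Finset ℕ) : Set ℕ) := by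
    ext k
    simp only [Set.mem_ofPred_eq, Finset.coe_filter, Finset.mem_Icc]
    constructor
    · rintro ⟨a, b⟩; exact ⟨⟨a, h1 k b⟩, b⟩
    · rintro ⟨⟨a, _⟩, b⟩; exact ⟨a, b⟩
  rw [conjFun, this, Set.ncard_coe_finset]

lemma scp_symm (l : SCP) {i j : ℕ} (hi : 1 ≤ i) (hj : 1 ≤ j) : j ≤ l.1 i ↔ i ≤ l.1 j := by
  rw [l.2.2 i hi, conj_iff l.2.1 hi hj]

lemma nat_eq_of_le_iff {a b : ℕ} (h : ∀ j, 1 ≤ j → (j ≤ a ↔ j ≤ b)) : a = b := by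
  rcases Nat.lt_trichotomy a b with h1 | h1 | h1
  · have := (h b (by omega)).2 le_rfl; omega
  · exact h1
  · have := (h a (by omega)).1 le_rfl; omega

lemma partSize_eq {f : ℕ → ℕ} {N : ℕ} (hf : IsPartitionFun f) (hN : ∀ i ≥ N, f i = 0) :
    partSize f = ∑ i ∈ Finset.Icc 1 N, f i := by
  rw [partSize]
  apply finsum_eq_sum_of_support_subset
  intro i hi
  simp only [Function.mem_support] at hi
  simp only [Finset.coe_Icc, Set.mem_Icc]
  constructor
  · by_contra h
    have : i = 0 := by omega
    exact hi (this ▸ hf.1)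
  · by_contra h
    exact hi (hN i (by omega))

lemma le_partSize {f : ℕ → ℕ} (hf : IsPartitionFun f) (i : ℕ) : f i ≤ partSize f := by
  obtain ⟨N, hN⟩ := hf.2.2
  by_cases h : f i = 0
  · omega
  rw [partSize_eq hf hN]
  apply Finset.single_le_sum (f := f) (fun _ _ => Nat.zero_le _)
  rw [Finset.mem_Icc]
  constructor
  · by_contra h'
    have : i = 0 := by omega
    exact h (this ▸ hf.1)
  · by_contra h'
    exact h (hN i (by omega))

noncomputable def diagSet (f : ℕ → ℕ) : Finset ℕ :=
  (Finset.range (partSize f + 1)).filter (fun i => 1 ≤ i ∧ i ≤ f i)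

lemma mem_diagSet {f : ℕ → ℕ} (hf : IsPartitionFun f) (i : ℕ) :
    i ∈ diagSet f ↔ 1 ≤ i ∧ i ≤ f i := by
  simp only [diagSet, Finset.mem_filter, Finset.mem_range]
  have := le_partSize hf i
  omega

noncomputable def frob (f : ℕ → ℕ) : Finset ℕ := (diagSet f).image (fun i => f i - i)

lemma frob_injOn {f : ℕ → ℕ} (hf : IsPartitionFun f) :
    Set.InjOn (fun i => f i - i) (diagSet f : Set ℕ) := by
  intro i hi j hj h
  simp only [Finset.mem_coe, mem_diagSet hf] at hi hj h
  rcases Nat.lt_trichotomy i j with h1 | h1 | h1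
  · have := hf.2.1 hi.1 h1.le; omega
  · exact h1
  · have := hf.2.1 hj.1 h1.le; omega

lemma sigmaFun_eq (s : ℂ) (l : SCP) : sigmaFun s l.1 =
    ∑ m ∈ frob l.1, (s ^ ((2 * m + 1 : ℕ) : ℤ) - s ^ (-((2 * m + 1 : ℕ) : ℤ))) := by
  rw [frob, Finset.sum_image (frob_injOn l.2.1)]
  rfl

lemma partSize_frob (l : SCP) : partSize l.1 = ∑ m ∈ frob l.1, (2 * m + 1) := by
  classical
  rw [frob, Finset.sum_image (frob_injOn l.2.1)]
  obtain ⟨f, hf, hsc⟩ := l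
  have hsymm : ∀ i j, 1 ≤ i → 1 ≤ j → (j ≤ f i ↔ i ≤ f j) :=
    fun i j hi hj => scp_symm ⟨f, hf, hsc⟩ hi hj
  change partSize f = ∑ i ∈ diagSet f, (2 * (f i - i) + 1)
  set M := partSize f with hMdef
  have hM : ∀ i, f i ≤ M := le_partSize hf
  have hz : ∀ i ≥ M + 1, f i = 0 := by
    intro i hi
    by_contra h
    have := (hsymm i 1 (by omega) le_rfl).1 (by omega)
    have := hM 1
    omega
  have e1 := partSize_eq hf hz
  rw [← hMdef] at e1
  have e2 : ∀ i, f i = ∑ j ∈ Finset.Icc 1 (M+1), if j ≤ f i then 1 else 0 := by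
    intro i
    rw [← Finset.card_filter]
    have : (Finset.Icc 1 (M+1)).filter (fun j => j ≤ f i) = Finset.Icc 1 (f i) := by
      ext j
      simp only [Finset.mem_filter, Finset.mem_Icc]
      have := hM i
      omega
    rw [this]; simp
  have e3 : ∀ i j, (if j ≤ f i then 1 else 0 : ℕ) =
      (if i ≤ j ∧ j ≤ f i then 1 else 0) + (if j < i ∧ j ≤ f i then 1 else 0) := by
    intro i j
    split_ifs <;> omega
  have e4 : ∑ i ∈ Finset.Icc 1 (M+1), ∑ j ∈ Finset.Icc 1 (M+1), (if j < i ∧ j ≤ f i then 1 else 0 : ℕ)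
      = ∑ i ∈ Finset.Icc 1 (M+1), ∑ j ∈ Finset.Icc 1 (M+1), (if i < j ∧ j ≤ f i then 1 else 0 : ℕ) := by
    rw [Finset.sum_comm]
    refine Finset.sum_congr rfl fun i hi => Finset.sum_congr rfl fun j hj => ?_
    simp only [Finset.mem_Icc] at hi hj
    simp only [hsymm i j hi.1 hj.1]
  have e5 : M = ∑ i ∈ Finset.Icc 1 (M+1), (((∑ j ∈ Finset.Icc 1 (M+1), (if i ≤ j ∧ j ≤ f i then 1 else 0 : ℕ)))
      + ∑ j ∈ Finset.Icc 1 (M+1), (if i < j ∧ j ≤ f i then 1 else 0 : ℕ)) := by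
    rw [Finset.sum_add_distrib, ← e4, ← Finset.sum_add_distrib]
    conv_lhs => rw [e1]
    refine Finset.sum_congr rfl fun i hi => ?_
    rw [← Finset.sum_add_distrib]
    conv_lhs => rw [e2 i]
    exact Finset.sum_congr rfl fun j hj => e3 i j
  have e6 : diagSet f = (Finset.Icc 1 (M+1)).filter (fun i => i ≤ f i) := by
    ext i
    rw [mem_diagSet hf]
    simp only [Finset.mem_filter, Finset.mem_Icc]
    have := hM i
    omega
  rw [e6, Finset.sum_filter]
  conv_lhs => rw [e5]
  refine Finset.sum_congr rfl fun i hi => ?_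
  rw [← Finset.card_filter, ← Finset.card_filter]
  simp only [Finset.mem_Icc] at hi
  have hMi := hM i
  have a1 : (Finset.Icc 1 (M+1)).filter (fun j => i ≤ j ∧ j ≤ f i) = Finset.Icc i (f i) := by
    ext j
    simp only [Finset.mem_filter, Finset.mem_Icc]
    omega
  have a2 : (Finset.Icc 1 (M+1)).filter (fun j => i < j ∧ j ≤ f i) = Finset.Ioc i (f i) := by
    ext j
    simp only [Finset.mem_filter, Finset.mem_Icc, Finset.mem_Ioc]
    omega
  rw [a1, a2, Nat.card_Icc, Nat.card_Ioc]
  split_ifs <;> omega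

/-- number of elements of `S` that are at least `k` -/
def cnt (S : Finset ℕ) (k : ℕ) : ℕ := (S.filter (fun m => k ≤ m)).card

lemma cnt_frob (l : SCP) {i k : ℕ} (hi : 1 ≤ i) : i ≤ cnt (frob l.1) k ↔ i + k ≤ l.1 i := by
  classical
  have hf := l.2.1
  rw [← count_iff (fun i => i + k ≤ l.1 i) (partSize l.1) (fun i h1 h => by
      have := hf.2.1 h1 (Nat.le_succ i); simp only [Nat.succ_eq_add_one] at this; omega)
    (fun i h => by have := le_partSize hf i; omega) i hi]
  have : cnt (frob l.1) k = ((Finset.Icc 1 (partSize l.1)).filter (fun i => i + k ≤ l.1 i)).card := by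
    rw [cnt, frob, Finset.filter_image, Finset.card_image_of_injOn]
    · congr 1
      ext i
      simp only [Finset.mem_filter, mem_diagSet hf, Finset.mem_Icc]
      have := le_partSize hf i
      omega
    · exact (frob_injOn hf).mono (by intro x hx; simp at hx; simp [hx.1])
  rw [this]

lemma frob_injective : Function.Injective (fun l : SCP => frob l.1) := by
  intro l l' h
  simp only at h
  have key : ∀ i j, 1 ≤ i → i ≤ j → (j ≤ l.1 i ↔ j ≤ l'.1 i) := by
    intro i j hi hij
    obtain ⟨k, rfl⟩ := Nat.exists_eq_add_of_le hij
    rw [← cnt_frob l hi, ← cnt_frob l' hi, h]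
  apply Subtype.ext
  funext i
  rcases Nat.eq_zero_or_pos i with rfl | hi
  · rw [l.2.1.1, l'.2.1.1]
  apply nat_eq_of_le_iff
  intro j hj
  rcases le_total i j with h1 | h1
  · exact key i j hi h1
  · rw [scp_symm l hi hj, scp_symm l' hi hj]
    exact key j i hj h1

lemma cnt_anti (S : Finset ℕ) {a b : ℕ} (h : a ≤ b) : cnt S b ≤ cnt S a := by
  apply Finset.card_le_card
  intro m
  simp only [Finset.mem_filter]
  exact fun hm => ⟨hm.1, h.trans hm.2⟩

lemma cnt_succ (S : Finset ℕ) (a : ℕ) : cnt S a = cnt S (a+1) + if a ∈ S then 1 else 0 := by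
  classical
  unfold cnt
  split_ifs with h
  · rw [← Finset.card_insert_of_notMem (a := a) (s := S.filter (fun m => a + 1 ≤ m)) (by simp)]
    congr 1
    ext m
    simp only [Finset.mem_filter, Finset.mem_insert]
    constructor
    · rintro ⟨h1, h2⟩
      rcases eq_or_lt_of_le h2 with h3 | h3
      · exact Or.inl h3.symm
      · exact Or.inr ⟨h1, h3⟩
    · rintro (rfl | ⟨h1, h2⟩)
      · exact ⟨h, le_rfl⟩
      · exact ⟨h1, by omega⟩
  · rw [add_zero]
    congr 1
    ext m
    simp only [Finset.mem_filter]
    constructor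
    · rintro ⟨h1, h2⟩
      refine ⟨h1, ?_⟩
      rcases eq_or_lt_of_le h2 with h3 | h3
      · exact absurd (h3 ▸ h1) h
      · exact h3
    · rintro ⟨h1, h2⟩; exact ⟨h1, by omega⟩

lemma cnt_zero (S : Finset ℕ) : cnt S (S.sup id + 1) = 0 := by
  rw [cnt, Finset.card_eq_zero, Finset.filter_eq_empty_iff]
  intro m hm h
  have := Finset.le_sup (f := id) hm
  simp only [id] at this
  omega

/-- cells of the diagram attached to `S` -/
def cell (S : Finset ℕ) (i j : ℕ) : Prop := 1 ≤ i ∧ 1 ≤ j ∧ min i j ≤ cnt S (max i j - min i j)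

lemma cell_symm (S : Finset ℕ) (i j : ℕ) : cell S i j ↔ cell S j i := by
  unfold cell
  rw [min_comm, max_comm]
  tauto

lemma cell_down (S : Finset ℕ) (i j : ℕ) (hj : 1 ≤ j) (h : cell S i (j+1)) : cell S i j := by
  obtain ⟨h1, h2, h3⟩ := h
  refine ⟨h1, hj, ?_⟩
  rcases le_or_gt i j with h4 | h4
  · rw [min_eq_left (by omega), max_eq_right (by omega)] at h3 ⊢
    exact h3.trans (cnt_anti S (by omega))
  · rw [min_eq_right (by omega), max_eq_left (by omega)] at h3 ⊢
    have := cnt_succ S (i - (j+1))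
    have e : i - (j+1) + 1 = i - j := by omega
    rw [e] at this
    split_ifs at this <;> omega

lemma cell_bound (S : Finset ℕ) (i j : ℕ) (h : cell S i j) : j ≤ S.card + S.sup id := by
  obtain ⟨h1, h2, h3⟩ := h
  have c1 : ∀ k, cnt S k ≤ S.card := fun k => Finset.card_filter_le _ _
  have h4 := c1 (max i j - min i j)
  by_contra hlt
  have : S.sup id + 1 ≤ max i j - min i j := by omega
  have := cnt_anti S this
  rw [cnt_zero] at this
  omega

open Classical in
noncomputable def ofSet (S : Finset ℕ) (i : ℕ) : ℕ :=
  ((Finset.Icc 1 (S.card + S.sup id)).filter (fun j => cell S i j)).card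

lemma le_ofSet (S : Finset ℕ) (i j : ℕ) (hj : 1 ≤ j) : j ≤ ofSet S i ↔ cell S i j := by
  classical
  rw [← count_iff (fun j => cell S i j) (S.card + S.sup id) (cell_down S i) (cell_bound S i) j hj]
  unfold ofSet
  convert Iff.rfl

lemma ofSet_part (S : Finset ℕ) : IsPartitionFun (ofSet S) := by
  refine ⟨?_, ?_, ?_⟩
  · by_contra h
    have := (le_ofSet S 0 1 le_rfl).1 (by omega)
    exact absurd this.1 (by omega)
  · intro i j hi hij
    induction j, hij using Nat.le_induction with
    | base => exact le_rfl
    | succ n hn ih =>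
      refine le_trans ?_ ih
      by_contra h
      have h1 := (le_ofSet S (n+1) (ofSet S (n+1)) (by omega)).1 le_rfl
      rw [cell_symm] at h1
      have h2 := cell_down S _ n (by omega) h1
      rw [cell_symm] at h2
      have h3 := (le_ofSet S n (ofSet S (n+1)) (by omega)).2 h2
      omega
  · refine ⟨S.card + S.sup id + 1, fun i hi => ?_⟩
    by_contra h
    have := (le_ofSet S i 1 le_rfl).1 (by omega)
    rw [cell_symm] at this
    have := cell_bound S _ _ this
    omega

lemma ofSet_sc (S : Finset ℕ) : SelfConjugate (ofSet S) := by
  intro k hk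
  apply nat_eq_of_le_iff
  intro j hj
  rw [conj_iff (ofSet_part S) hk hj, le_ofSet S k j hj, le_ofSet S j k hk, cell_symm]

lemma frob_surjective : Function.Surjective (fun l : SCP => frob l.1) := by
  intro S
  refine ⟨⟨ofSet S, ofSet_part S, ofSet_sc S⟩, ?_⟩
  ext x
  have hc : ∀ i k, 1 ≤ i → (i + k ≤ ofSet S i ↔ i ≤ cnt S k) := by
    intro i k hi
    rw [le_ofSet S i (i+k) (by omega)]
    unfold cell
    rw [min_eq_left (by omega), max_eq_right (by omega)]
    have : i + k - i = k := by omega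
    rw [this]
    exact ⟨fun h => h.2.2, fun h => ⟨hi, by omega, h⟩⟩
  simp only [frob, Finset.mem_image, mem_diagSet (ofSet_part S)]
  have hx := cnt_succ S x
  constructor
  · rintro ⟨i, ⟨h1, h2⟩, h3⟩
    have a := (hc i x h1).1 (by omega)
    have b := mt (hc i (x+1) h1).2 (by omega)
    by_contra h
    rw [if_neg h] at hx
    omega
  · intro h
    rw [if_pos h] at hx
    refine ⟨cnt S x, ⟨by omega, ?_⟩, ?_⟩
    · have := (hc (cnt S x) x (by omega)).2 le_rfl
      omega
    · have := (hc (cnt S x) x (by omega)).2 le_rfl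
      have := mt (hc (cnt S x) (x+1) (by omega)).1 (by omega)
      omega

noncomputable def scpEquiv : SCP ≃ Finset ℕ :=
  Equiv.ofBijective (fun l : SCP => frob l.1) ⟨frob_injective, frob_surjective⟩

/-- toggle membership of `m` -/
def toggle (m : ℕ) (S : Finset ℕ) : Finset ℕ := if m ∈ S then S.erase m else insert m S

lemma mem_toggle (m : ℕ) (S : Finset ℕ) : m ∈ toggle m S ↔ m ∉ S := by
  unfold toggle
  split_ifs with h <;> simp [h]

lemma toggle_toggle (m : ℕ) (S : Finset ℕ) : toggle m (toggle m S) = S := by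
  unfold toggle
  by_cases h : m ∈ S
  · simp [h]
  · simp [h]

def toggleEquiv (m : ℕ) : Finset ℕ ≃ Finset ℕ :=
  ⟨toggle m, toggle m, toggle_toggle m, toggle_toggle m⟩

def toggleEquiv' : ℕ × Finset ℕ ≃ ℕ × Finset ℕ :=
  ⟨fun p => (p.1, toggle p.1 p.2), fun p => (p.1, toggle p.1 p.2),
    fun p => by simp [toggle_toggle], fun p => by simp [toggle_toggle]⟩

lemma toggle_weight (x : ℕ → ℂ) (m : ℕ) (S : Finset ℕ) :
    (if m ∈ toggle m S then ∏ i ∈ toggle m S, x i else 0)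
      = x m * (if m ∈ S then 0 else ∏ i ∈ S, x i) := by
  by_cases h : m ∈ S
  · have : m ∉ toggle m S := by rw [mem_toggle]; simpa using h
    simp [h, this]
  · have : m ∈ toggle m S := by rw [mem_toggle]; exact h
    rw [if_pos this, if_neg h, toggle, if_neg h, Finset.prod_insert h]

lemma weighted_sum (x a : ℕ → ℂ) (hx : Summable (fun m => ‖x m‖))
    (ha : Summable (fun m => ‖a m * x m‖)) (h1 : ∀ m, 1 + x m ≠ 0) :
    HasSum (fun m => a m * (x m / (1 + x m)))
      ((∑' S : Finset ℕ, (∏ i ∈ S, x i) * ∑ m ∈ S, a m) / ∑' S : Finset ℕ, ∏ i ∈ S, x i) := by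
  have hw : Summable (fun S : Finset ℕ => ∏ i ∈ S, x i) := summable_finsetProd_of_summable_norm hx
  have hwn : Summable (fun S : Finset ℕ => ‖∏ i ∈ S, x i‖) := hw.norm
  have hZ : ∑' S : Finset ℕ, ∏ i ∈ S, x i ≠ 0 := by
    rw [← tprod_one_add hw]
    exact tprod_one_add_ne_zero_of_summable h1 hx
  set Z := ∑' S : Finset ℕ, ∏ i ∈ S, x i with hZdef
  let F : ℕ × Finset ℕ → ℂ := fun p => a p.1 * (if p.1 ∈ p.2 then ∏ i ∈ p.2, x i else 0)
  have hF : Summable F := by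
    rw [← toggleEquiv'.summable_iff]
    refine Summable.of_norm_bounded (g := fun p : ℕ × Finset ℕ => ‖a p.1 * x p.1‖ * ‖∏ i ∈ p.2, x i‖)
      (ha.mul_of_nonneg hwn (fun _ => norm_nonneg _) (fun _ => norm_nonneg _)) ?_
    rintro ⟨m, S⟩
    change ‖a m * (if m ∈ toggle m S then ∏ i ∈ toggle m S, x i else 0)‖ ≤ ‖a m * x m‖ * ‖∏ i ∈ S, x i‖
    rw [toggle_weight, ← mul_assoc, norm_mul]
    refine mul_le_mul_of_nonneg_left ?_ (norm_nonneg _)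
    split_ifs
    · rw [norm_zero]; exact norm_nonneg _
    · exact le_rfl
  have hA : ∀ m, ∑' S : Finset ℕ, (if m ∈ S then ∏ i ∈ S, x i else 0) = x m / (1 + x m) * Z := by
    intro m
    have sA : Summable (fun S : Finset ℕ => if m ∈ S then ∏ i ∈ S, x i else 0) := by
      refine Summable.of_norm_bounded hwn fun S => ?_
      split_ifs
      · exact le_rfl
      · rw [norm_zero]; exact norm_nonneg _
    have sB : Summable (fun S : Finset ℕ => if m ∈ S then 0 else ∏ i ∈ S, x i) := by
      refine Summable.of_norm_bounded hwn fun S => ?_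
      split_ifs
      · rw [norm_zero]; exact norm_nonneg _
      · exact le_rfl
    have e1 : ∑' S : Finset ℕ, (if m ∈ S then ∏ i ∈ S, x i else 0)
        = x m * ∑' S : Finset ℕ, (if m ∈ S then 0 else ∏ i ∈ S, x i) := by
      rw [← (toggleEquiv m).tsum_eq, ← tsum_mul_left]
      exact tsum_congr fun S => toggle_weight x m S
    have e2 : Z = ∑' S : Finset ℕ, (if m ∈ S then ∏ i ∈ S, x i else 0)
        + ∑' S : Finset ℕ, (if m ∈ S then 0 else ∏ i ∈ S, x i) := by
      rw [← sA.tsum_add sB]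
      exact tsum_congr fun S => by split_ifs <;> simp
    have := h1 m
    field_simp
    linear_combination e1 - x m * e2
  have hcol : ∀ m, ∑' S, F (m, S) = a m * (x m / (1 + x m)) * Z := by
    intro m
    simp only [F]
    rw [tsum_mul_left, hA, mul_assoc]
  have hrow : ∀ S : Finset ℕ, ∑' m, F (m, S) = (∏ i ∈ S, x i) * ∑ m ∈ S, a m := by
    intro S
    rw [tsum_eq_sum (s := S) (fun m hm => by simp [F, hm]), Finset.mul_sum]
    exact Finset.sum_congr rfl fun m hm => by simp [F, hm, mul_comm]
  have key : ∑' S : Finset ℕ, (∏ i ∈ S, x i) * ∑ m ∈ S, a m = ∑' m, ∑' S, F (m, S) := by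
    simp_rw [← hrow]
    exact Summable.tsum_comm (f := fun m S => F (m, S)) hF
  rw [key]
  have hs : HasSum (fun m => ∑' S, F (m, S)) (∑' m, ∑' S, F (m, S)) := hF.prod.hasSum
  have := hs.div_const Z
  simp_rw [hcol] at this ⊢
  have hfun : (fun m => a m * (x m / (1 + x m)) * Z / Z) = fun m => a m * (x m / (1 + x m)) :=
    funext fun m => mul_div_cancel_right₀ _ hZ
  rw [hfun] at this
  exact this

lemma onePoint_hasSum (q s : ℂ) (hq0 : 0 < ‖q‖) (hq1 : ‖q‖ < 1)
    (h1 : ‖q‖ < ‖s‖) (h2 : ‖q * s‖ < 1) :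
    HasSum (fun m : ℕ => (s ^ (2 * m + 1) - s⁻¹ ^ (2 * m + 1)) *
      (q ^ (2 * m + 1) / (1 + q ^ (2 * m + 1)))) (onePoint q s - 1 / (s - s⁻¹)) := by
  have geo : ∀ z : ℂ, ‖z‖ < 1 → Summable (fun m : ℕ => ‖z ^ (2 * m + 1)‖) := by
    intro z hz
    have : Summable (fun n : ℕ => ‖z ^ n‖) := by
      simp_rw [norm_pow]
      exact summable_geometric_of_lt_one (norm_nonneg _) hz
    exact this.comp_injective (i := fun m : ℕ => 2 * m + 1) (fun a b h => by simpa using h)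
  have hne : ∀ m : ℕ, 1 + q ^ (2 * m + 1) ≠ 0 := by
    intro m h
    have : ‖q ^ (2 * m + 1)‖ = 1 := by
      rw [eq_neg_of_add_eq_zero_right h]; simp
    rw [norm_pow] at this
    have := pow_lt_one₀ (norm_nonneg q) hq1 (show 2 * m + 1 ≠ 0 by omega)
    linarith
  have hqs : ‖q * s⁻¹‖ < 1 := by
    rw [norm_mul, norm_inv, ← div_eq_mul_inv, div_lt_one (hq0.trans h1)]
    exact h1
  have := weighted_sum (fun m => q ^ (2 * m + 1)) (fun m => s ^ (2 * m + 1) - s⁻¹ ^ (2 * m + 1))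
    (geo q hq1) (by
      refine Summable.of_nonneg_of_le (fun _ => norm_nonneg _) (fun m => ?_)
        ((geo _ h2).add (geo _ hqs))
      have : (s ^ (2 * m + 1) - s⁻¹ ^ (2 * m + 1)) * q ^ (2 * m + 1)
        = (q * s) ^ (2 * m + 1) - (q * s⁻¹) ^ (2 * m + 1) := by
        rw [mul_pow, mul_pow]; ring
      rw [this]
      exact norm_sub_le _ _) hne
  convert this using 1
  rw [onePoint, add_sub_cancel_left]
  have hp : ∀ l : SCP, q ^ partSize l.1 = ∏ i ∈ scpEquiv l, q ^ (2 * i + 1) := by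
    intro l
    rw [Finset.prod_pow_eq_pow_sum, partSize_frob]; rfl
  have hsg : ∀ l : SCP, sigmaFun s l.1 = ∑ m ∈ scpEquiv l, (s ^ (2 * m + 1) - s⁻¹ ^ (2 * m + 1)) := by
    intro l
    rw [sigmaFun_eq]
    refine Finset.sum_congr rfl fun m _ => ?_
    rw [zpow_neg, zpow_natCast, inv_pow]
  congr 1
  · rw [← scpEquiv.tsum_eq]
    exact tsum_congr fun l => by rw [hp, hsg]
  · rw [← scpEquiv.tsum_eq]
    exact tsum_congr fun l => hp l

lemma odd_geo (z : ℂ) (hz : ‖z‖ < 1) :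
    HasSum (fun m : ℕ => z ^ (2 * m + 1)) (z / (1 - z ^ 2)) := by
  have : ‖z ^ 2‖ < 1 := by rw [norm_pow]; exact pow_lt_one₀ (norm_nonneg _) hz two_ne_zero
  have := (hasSum_geometric_of_norm_lt_one this).mul_left z
  have hfun : (fun m : ℕ => z * (z ^ 2) ^ m) = fun m => z ^ (2 * m + 1) := by
    funext m
    rw [pow_succ z (2 * m), pow_mul, mul_comm]
  rw [hfun] at this
  exact this

/-- The `q`-difference equation `G(q²t) = −G(t)` for the one-point function of
self-conjugate partitions (as an identity of meromorphic continuations in `t`;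
`q²t` has the square root `q·s`). -/
theorem onePoint_q_difference (q s : ℂ) (hq0 : 0 < ‖q‖) (hq1 : ‖q‖ < 1)
    (hs1 : 1 < ‖s‖) (hs2 : ‖s‖ ^ 2 < ‖q‖⁻¹) :
    onePoint q (q * s) = -onePoint q s := by

  have hq : q ≠ 0 := norm_pos_iff.1 hq0
  have hs : s ≠ 0 := norm_pos_iff.1 (by linarith)
  have hss : ‖q‖ * ‖s‖ ^ 2 < 1 := by
    have := mul_lt_mul_of_pos_left hs2 hq0
    rwa [mul_inv_cancel₀ hq0.ne'] at this
  have hqs : ‖q * s‖ < 1 := by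
    rw [norm_mul]
    nlinarith [mul_pos hq0 (by linarith : 0 < ‖s‖)]
  have hqs' : ‖q‖ < ‖q * s‖ := by rw [norm_mul]; nlinarith
  have hqqs : ‖q * (q * s)‖ < 1 := by
    rw [norm_mul]; nlinarith [norm_nonneg (q * s)]
  have hsi : ‖s⁻¹‖ < 1 := by rw [norm_inv]; exact inv_lt_one_of_one_lt₀ hs1
  have A := onePoint_hasSum q s hq0 hq1 (by linarith) hqs
  have B := onePoint_hasSum q (q * s) hq0 hq1 hqs' hqqs
  have C := (odd_geo _ hqs).sub (odd_geo _ hsi)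
  have AB := A.add B
  have hfun : (fun m : ℕ => (s ^ (2 * m + 1) - s⁻¹ ^ (2 * m + 1)) * (q ^ (2 * m + 1) / (1 + q ^ (2 * m + 1)))
      + ((q * s) ^ (2 * m + 1) - (q * s)⁻¹ ^ (2 * m + 1)) * (q ^ (2 * m + 1) / (1 + q ^ (2 * m + 1))))
      = fun m => (q * s) ^ (2 * m + 1) - s⁻¹ ^ (2 * m + 1) := by
    funext m
    have hne : 1 + q ^ (2 * m + 1) ≠ 0 := by
      intro h
      have : ‖q ^ (2 * m + 1)‖ = 1 := by
        rw [eq_neg_of_add_eq_zero_right h]; simp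
      rw [norm_pow] at this
      have := pow_lt_one₀ (norm_nonneg q) hq1 (show 2 * m + 1 ≠ 0 by omega)
      linarith
    rw [mul_inv, mul_pow, mul_pow, inv_pow, inv_pow]
    have := pow_ne_zero (2 * m + 1) hq
    have := pow_ne_zero (2 * m + 1) hs
    generalize q ^ (2 * m + 1) = u at *
    generalize s ^ (2 * m + 1) = v at *
    field_simp
    ring
  rw [hfun] at AB
  have e := HasSum.unique AB C
  have n1 : 1 - (q * s) ^ 2 ≠ 0 := by
    intro h
    have h' : ‖(q * s) ^ 2‖ = 1 := by rw [← sub_eq_zero.1 h]; simp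
    rw [norm_pow] at h'
    have := pow_lt_one₀ (norm_nonneg (q * s)) hqs two_ne_zero
    linarith
  have n2 : s ^ 2 - 1 ≠ 0 := by
    intro h
    have h' : ‖s ^ 2‖ = 1 := by rw [sub_eq_zero.1 h]; simp
    rw [norm_pow] at h'
    nlinarith
  have z1 : q * s / (1 - (q * s) ^ 2) = - (1 / (q * s - (q * s)⁻¹)) := by
    have : q * s - (q * s)⁻¹ = - ((1 - (q * s) ^ 2) / (q * s)) := by field_simp; ring
    rw [this, div_neg, neg_neg, one_div_div]
  have z2 : s⁻¹ / (1 - s⁻¹ ^ 2) = 1 / (s - s⁻¹) := by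
    have a : s - s⁻¹ = (s ^ 2 - 1) / s := by field_simp
    have b : 1 - s⁻¹ ^ 2 = (s ^ 2 - 1) / s ^ 2 := by field_simp
    rw [a, b]
    field_simp
  rw [z1, z2] at e
  linear_combination e
end
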